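/- Let (G, M, I) be a finite formal context and let c = (A, B) be a formal concept. A subset H ⊆ A satisfies H'' = A if and only if H intersects every extensional face of c, i.e., H ∩ (A \ A_l) ≠ ∅ for every lower cover c_l = (A_l, B_l) of c in the concept lattice. (Dual, extensional version of the generator–blocker correspondence, used by the extensional version of the Minigen procedure.) -/

import Mathlib

/-- The derivation `A'`: attributes common to all objects of `A`. -/
def intentOf {G M : Type*} (I : Set (G × M)) (A : Set G) : Set M :=
  {m | ∀ g ∈ A, (g, m) ∈ I}

/-- The derivation `B'`: objects sharing all attributes of `B`. -/
def extentOf {G M : Type*} (I : Set (G × M)) (B : Set M) : Set G :=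
  {g | ∀ m ∈ B, (g, m) ∈ I}

/-- A formal concept of the context `(G, M, I)`: a pair `(A, B)` with `A' = B` and `B' = A`. -/
def IsConcept {G M : Type*} (I : Set (G × M)) (A : Set G) (B : Set M) : Prop :=
  intentOf I A = B ∧ extentOf I B = A

/-- `(Ad, Bd)` is an upper cover of the concept `(A, B)`: it is a concept strictly above
`(A, B)` (concepts are ordered by inclusion of extents) with no concept strictly between. -/
def IsUpperCover {G M : Type*} (I : Set (G × M)) (A : Set G) (_B : Set M)
    (Ad : Set G) (Bd : Set M) : Prop :=
  IsConcept I Ad Bd ∧ A ⊂ Ad ∧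
    ∀ A₃ : Set G, ∀ B₃ : Set M, IsConcept I A₃ B₃ → ¬(A ⊂ A₃ ∧ A₃ ⊂ Ad)

/-- `(Al, Bl)` is a lower cover of the concept `(A, B)`: it is a concept strictly below
`(A, B)` (concepts are ordered by inclusion of extents) with no concept strictly between. -/
def IsLowerCover {G M : Type*} (I : Set (G × M)) (A : Set G) (_B : Set M)
    (Al : Set G) (Bl : Set M) : Prop :=
  IsConcept I Al Bl ∧ Al ⊂ A ∧
    ∀ A₃ : Set G, ∀ B₃ : Set M, IsConcept I A₃ B₃ → ¬(Al ⊂ A₃ ∧ A₃ ⊂ A)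

/-- Dual (extensional) generator–blocker correspondence: for `H ⊆ A`, one has `H′′ = A`
iff `H` meets the extensional face `A \ A_l` of every lower cover `(A_l, B_l)`. -/
theorem extensional_generator_iff_blocker {G M : Type*} [Finite G] [Finite M]
    (I : Set (G × M)) (A : Set G) (B : Set M) (h : IsConcept I A B)
    (H : Set G) (hHA : H ⊆ A) :
    extentOf I (intentOf I H) = A ↔
      ∀ (Al : Set G) (Bl : Set M), IsLowerCover I A B Al Bl →
        (H ∩ (A \ Al)).Nonempty := by
  obtain ⟨hAB, hBA⟩ := h
  have hle : extentOf I (intentOf I H) ⊆ A := by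
    intro g hg
    rw [← hBA, ← hAB]
    intro m hm
    exact hg m (fun x hx => hm x (hHA hx))
  have hH : H ⊆ extentOf I (intentOf I H) := fun g hg m hm => hm g hg
  constructor
  · rintro hgen Al Bl ⟨⟨hl1, hl2⟩, hlt, -⟩
    by_contra hne
    have hHl : H ⊆ Al := by
      intro g hg
      by_contra hgl
      exact hne ⟨g, hg, hHA hg, hgl⟩
    apply hlt.2
    rw [← hgen, ← hl2, ← hl1]
    intro g hg m hm
    exact hg m (fun x hx => hm x (hHl hx))
  · intro hall
    by_contra hne
    have hfin : {X : Set G | H ⊆ X ∧ X ⊂ A ∧ ∃ Y, IsConcept I X Y}.Finite := Set.toFinite _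
    have hnon : {X : Set G | H ⊆ X ∧ X ⊂ A ∧ ∃ Y, IsConcept I X Y}.Nonempty := by
      refine ⟨_, hH, lt_of_le_of_ne hle hne, intentOf I H, ?_, rfl⟩
      apply Set.Subset.antisymm
      · intro m hm g hg
        exact hm g (hH hg)
      · intro m hm g hg
        exact hg m hm
    obtain ⟨X, hX⟩ := hfin.exists_maximal hnon
    obtain ⟨hHX, hXA, Y, hXY⟩ := hX.prop
    obtain ⟨g, hgH, -, hgX⟩ := hall X Y ⟨hXY, hXA, fun A₃ B₃ h₃ hb =>
      hb.1.2 (hX.le_of_ge ⟨hHX.trans hb.1.1, hb.2, B₃, h₃⟩ hb.1.1)⟩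
    exact hgX (hHX hgH)
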